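/- Let ξ, z ∈ ℂ with Re(ξ) > 0 and |arg z| < π (i.e., z ∉ (−∞, 0]), and let c be a real number with 0 < c < Re(ξ). Then the Mellin–Barnes integral (1/2πi) ∫_{c − i∞}^{c + i∞} Γ(ξ − w) Γ(w) z^{−w} dw converges absolutely and equals Γ(ξ) (1 + z)^{−ξ}, where z^{−w} and (1+z)^{−ξ} are defined using the principal branch of the logarithm. -/

import Mathlib

open MeasureTheory

open Set Filter Topology

namespace Complex

lemma norm_cpow_mul_exp_neg_mul (s r : ℂ) {t : ℝ} (ht : 0 < t) :
    ‖(t : ℂ) ^ (s - 1) * exp (-(r * t))‖ = t ^ (s.re - 1) * Real.exp (-(r.re * t)) := by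
  rw [norm_mul, norm_cpow_eq_rpow_re_of_pos ht, norm_exp]
  simp

lemma integrableOn_rpow_mul_exp_neg_mul {s r : ℝ} (hs : 0 < s) (hr : 0 < r) :
    IntegrableOn (fun t : ℝ => t ^ (s - 1) * Real.exp (-(r * t))) (Ioi 0) := by
  simpa using integrableOn_rpow_mul_exp_neg_mul_rpow (p := 1) (s := s - 1) (by linarith)
    one_pos hr

lemma integrableOn_cpow_mul_exp_neg_mul {s r : ℂ} (hs : 0 < s.re) (hr : 0 < r.re) :
    IntegrableOn (fun t : ℝ => (t : ℂ) ^ (s - 1) * exp (-(r * t))) (Ioi 0) := by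
  refine (integrableOn_rpow_mul_exp_neg_mul hs hr).mono' (by fun_prop) ?_
  filter_upwards [ae_restrict_mem measurableSet_Ioi] with t ht
  exact (norm_cpow_mul_exp_neg_mul s r ht).le

lemma differentiableAt_integral_cpow_mul_exp_neg_mul {s r : ℂ} (hs : 0 < s.re) (hr : 0 < r.re) :
    DifferentiableAt ℂ
      (fun r : ℂ => ∫ t : ℝ in Ioi 0, (t : ℂ) ^ (s - 1) * exp (-(r * t))) r := by
  refine (hasDerivAt_integral_of_dominated_loc_of_deriv_le (μ := volume.restrict (Ioi 0))
    (F := fun (r : ℂ) (t : ℝ) => (t : ℂ) ^ (s - 1) * exp (-(r * t)))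
    (F' := fun (r : ℂ) (t : ℝ) => (t : ℂ) ^ (s - 1) * (exp (-(r * t)) * (-t)))
    (bound := fun t => t ^ (s.re + 1 - 1) * Real.exp (-(r.re / 2 * t)))
    (s := {q : ℂ | r.re / 2 < q.re}) ?_ ?_ (integrableOn_cpow_mul_exp_neg_mul hs hr) ?_ ?_
    (integrableOn_rpow_mul_exp_neg_mul (by linarith) (by linarith)) ?_).2.differentiableAt
  · exact (isOpen_lt continuous_const continuous_re).mem_nhds (by simp; linarith)
  · exact .of_forall fun q => by fun_prop
  · fun_prop
  · filter_upwards [ae_restrict_mem measurableSet_Ioi] with t ht q hq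
    have ht : 0 < t := ht
    rw [← mul_assoc, norm_mul, norm_cpow_mul_exp_neg_mul s q ht, norm_neg, norm_real,
      Real.norm_of_nonneg ht.le, add_sub_right_comm, Real.rpow_add_one ht.ne', mul_right_comm]
    gcongr
  · filter_upwards with t q _
    refine HasDerivAt.const_mul _ (HasDerivAt.cexp ?_)
    simpa using! ((hasDerivAt_id q).mul_const (t : ℂ)).neg

/-- The Gamma integral with a complex rate `r` in the right half-plane. -/
lemma integral_cpow_mul_exp_neg_mul_Ioi_of_re_pos {s r : ℂ} (hs : 0 < s.re) (hr : 0 < r.re) :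
    ∫ t : ℝ in Ioi 0, (t : ℂ) ^ (s - 1) * exp (-(r * t)) = r ^ (-s) * Gamma s := by
  have hU : IsOpen {q : ℂ | 0 < q.re} := isOpen_lt continuous_const continuous_re
  have hf : AnalyticOnNhd ℂ
      (fun r : ℂ => ∫ t : ℝ in Ioi 0, (t : ℂ) ^ (s - 1) * exp (-(r * t))) {q : ℂ | 0 < q.re} :=
    DifferentiableOn.analyticOnNhd (fun q hq =>
      (differentiableAt_integral_cpow_mul_exp_neg_mul hs hq).differentiableWithinAt) hU
  have hg : AnalyticOnNhd ℂ (fun r : ℂ => r ^ (-s) * Gamma s) {q : ℂ | 0 < q.re} :=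
    DifferentiableOn.analyticOnNhd (fun q hq =>
      ((differentiableAt_id.cpow_const (Or.inl hq)).mul_const _).differentiableWithinAt) hU
  refine hf.eqOn_of_preconnected_of_frequently_eq hg
    (convex_halfSpace_re_gt 0).isPreconnected (z₀ := 1) (by simp) ?_ hr
  have hmap : Tendsto (fun n : ℕ => ((1 + 1 / ((n : ℝ) + 1) : ℝ) : ℂ)) atTop (𝓝[≠] 1) := by
    refine tendsto_nhdsWithin_iff.2 ⟨?_, .of_forall fun n => ?_⟩
    · have := (tendsto_one_div_add_atTop_nhds_zero_nat (𝕜 := ℝ)).const_add 1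
      simpa [Function.comp_def] using (continuous_ofReal.tendsto _).comp this
    · have : (0 : ℝ) < 1 / ((n : ℝ) + 1) := by positivity
      rw [mem_compl_singleton_iff, Ne, ofReal_eq_one]
      linarith
  refine hmap.frequently (Frequently.of_forall fun n => ?_)
  have hn : (0 : ℝ) < 1 + 1 / ((n : ℝ) + 1) := by positivity
  rw [integral_cpow_mul_exp_neg_mul_Ioi hs hn, one_div, inv_cpow _ _ (by
    rw [arg_ofReal_of_nonneg hn.le]; exact Real.pi_pos.ne), cpow_neg]

lemma mul_cpow_of_arg_add_mem_Ioc {x y : ℂ} (hx : x ≠ 0) (hy : y ≠ 0)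
    (h : arg x + arg y ∈ Ioc (-Real.pi) Real.pi) (s : ℂ) : (x * y) ^ s = x ^ s * y ^ s := by
  rw [cpow_def_of_ne_zero (mul_ne_zero hx hy), cpow_def_of_ne_zero hx, cpow_def_of_ne_zero hy,
    log_mul hx hy h, add_mul, exp_add]

/-- The Mellin transform of `x ↦ Γ(ξ) (a + b x) ^ (-ξ)`. -/
lemma hasMellin_Gamma_mul_add_mul_cpow {a b s ξ : ℂ} (ha : 0 < a.re) (hb : 0 < b.re)
    (hs : 0 < s.re) (hsξ : s.re < ξ.re) :
    HasMellin (fun x : ℝ => Gamma ξ * (a + b * x) ^ (-ξ)) s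
      (Gamma (ξ - s) * Gamma s * (a ^ (s - ξ) * b ^ (-s))) := by
  have hb0 : b ≠ 0 := by rintro rfl; simp at hb
  set F : ℝ → ℝ → ℂ := fun x u =>
    (x : ℂ) ^ (s - 1) * ((u : ℂ) ^ (ξ - 1) * exp (-((a + b * x) * u))) with hF
  have hF' (x u : ℝ) : F x u = ((u : ℂ) ^ (ξ - 1) * exp (-(a * u))) *
      ((x : ℂ) ^ (s - 1) * exp (-((u * b) * x))) := by
    rw [hF]
    have : -((a + b * x) * u) = -(a * u) + -((u * b) * x) := by ring
    simp only [this, exp_add]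
    ring
  have hub {u : ℝ} (hu : 0 < u) : 0 < (u * b).re := by
    rw [re_ofReal_mul]; positivity
  have hint : Integrable (Function.uncurry F)
      ((volume.restrict (Ioi 0)).prod (volume.restrict (Ioi 0))) := by
    rw [integrable_prod_iff' (by unfold Function.uncurry; fun_prop)]
    constructor
    · filter_upwards [ae_restrict_mem measurableSet_Ioi] with u hu
      simp only [Function.uncurry, hF']
      exact (integrableOn_cpow_mul_exp_neg_mul hs (hub hu)).const_mul _
    · have := (integrableOn_rpow_mul_exp_neg_mul (s := ξ.re - s.re) (sub_pos.2 hsξ) ha).const_mul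
        ((1 / b.re) ^ s.re * Real.Gamma s.re)
      refine this.congr ?_
      filter_upwards [ae_restrict_mem measurableSet_Ioi] with u hu
      have hu : 0 < u := hu
      simp only [Function.uncurry, hF', norm_mul (_ * _) (_ * _), integral_const_mul]
      rw [norm_cpow_mul_exp_neg_mul _ _ hu, setIntegral_congr_fun measurableSet_Ioi
        (fun x hx => norm_cpow_mul_exp_neg_mul s (u * b) hx),
        Real.integral_rpow_mul_exp_neg_mul_Ioi hs (hub hu), re_ofReal_mul, Real.div_rpow one_pos.le hb.le,
        Real.div_rpow one_pos.le (mul_pos hu hb).le, Real.mul_rpow hu.le hb.le, Real.one_rpow,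
        sub_right_comm, Real.rpow_sub hu]
      field_simp
  have hinner {x : ℝ} (hx : 0 < x) : ∫ u in Ioi (0 : ℝ), F x u =
      (x : ℂ) ^ (s - 1) • (Gamma ξ * (a + b * x) ^ (-ξ)) := by
    have : 0 < (a + b * x).re := by
      rw [add_re, mul_comm b, re_ofReal_mul]; positivity
    rw [hF, integral_const_mul, integral_cpow_mul_exp_neg_mul_Ioi_of_re_pos (hs.trans hsξ) this,
      smul_eq_mul, mul_comm (Gamma ξ)]
  have hinner' {u : ℝ} (hu : 0 < u) : ∫ x in Ioi (0 : ℝ), F x u =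
      b ^ (-s) * Gamma s * ((u : ℂ) ^ (ξ - s - 1) * exp (-(a * u))) := by
    simp only [hF', integral_const_mul]
    rw [integral_cpow_mul_exp_neg_mul_Ioi_of_re_pos hs (hub hu), mul_cpow_of_arg_add_mem_Ioc
      (ofReal_ne_zero.2 hu.ne') hb0 (by simpa [arg_ofReal_of_nonneg hu.le] using arg_mem_Ioc b),
      sub_right_comm, sub_eq_add_neg (ξ - 1), cpow_add _ _ (ofReal_ne_zero.2 hu.ne')]
    ring
  constructor
  · refine (hint.integral_prod_left).congr ?_
    filter_upwards [ae_restrict_mem measurableSet_Ioi] with x hx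
    exact hinner hx
  · rw [mellin, ← setIntegral_congr_fun measurableSet_Ioi (fun x hx => hinner hx),
      integral_integral_swap hint, setIntegral_congr_fun measurableSet_Ioi (fun u hu => hinner' hu),
      integral_const_mul, integral_cpow_mul_exp_neg_mul_Ioi_of_re_pos (by simpa using hsξ) ha,
      neg_sub]
    ring

lemma norm_Gamma_mul_exp_le {s : ℂ} {θ : ℝ} (hs : 0 < s.re) (hθ : |θ| < Real.pi / 2) :
    ‖Gamma s‖ * Real.exp (θ * s.im) ≤ (1 / Real.cos θ) ^ s.re * Real.Gamma s.re := by
  have hcos : 0 < Real.cos θ := Real.cos_pos_of_mem_Ioo (abs_lt.1 hθ)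
  have hre : (exp (θ * I)).re = Real.cos θ := by simp [exp_re]
  have hθ' := abs_lt.1 hθ
  have hpow : ‖exp (θ * I) ^ (-s)‖ = Real.exp (θ * s.im) := by
    rw [cpow_def_of_ne_zero (exp_ne_zero _), log_exp (by simp; linarith) (by simp; linarith),
      norm_exp]
    simp
  rw [mul_comm, ← hpow, ← norm_mul,
    ← integral_cpow_mul_exp_neg_mul_Ioi_of_re_pos hs (hre ▸ hcos),
    ← Real.integral_rpow_mul_exp_neg_mul_Ioi hs hcos]
  refine (norm_integral_le_integral_norm _).trans_eq
    (setIntegral_congr_fun measurableSet_Ioi fun t ht => ?_)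
  simp only [norm_cpow_mul_exp_neg_mul s _ ht, hre]

/-- Exponential decay of the Gamma function on vertical lines, at any rate below `π / 2`. -/
lemma norm_Gamma_le_exp_neg_mul_abs_im {s : ℂ} {θ : ℝ} (hs : 0 < s.re) (hθ : |θ| < Real.pi / 2) :
    ‖Gamma s‖ ≤ (1 / Real.cos θ) ^ s.re * Real.Gamma s.re * Real.exp (-(θ * |s.im|)) := by
  rw [Real.exp_neg, ← div_eq_mul_inv, le_div_iff₀ (Real.exp_pos _)]
  rcases abs_cases s.im with h | h
  · rw [h.1]
    exact norm_Gamma_mul_exp_le hs hθ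
  · simpa [h.1] using norm_Gamma_mul_exp_le (θ := -θ) hs (by rwa [abs_neg])

lemma integrable_exp_neg_mul_abs {k : ℝ} (hk : 0 < k) :
    Integrable fun t : ℝ => Real.exp (-(k * |t|)) := by
  rw [← integrableOn_univ, ← Iic_union_Ioi (a := (0 : ℝ))]
  refine IntegrableOn.union ?_ ?_
  · refine (integrableOn_exp_mul_Iic hk 0).congr_fun (fun t ht => ?_) measurableSet_Iic
    simp [abs_of_nonpos (mem_Iic.1 ht)]
  · refine (integrableOn_exp_mul_Ioi (neg_lt_zero.2 hk) 0).congr_fun (fun t ht => ?_)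
      measurableSet_Ioi
    simp [abs_of_pos (mem_Ioi.1 ht)]

lemma integrable_Gamma_mul_Gamma_mul_cpow {ξ z : ℂ} (hz : z ∈ slitPlane) {c : ℝ} (hc0 : 0 < c)
    (hcξ : c < ξ.re) :
    Integrable fun t : ℝ => Gamma (ξ - (c + t * I)) * Gamma (c + t * I) * z ^ (-(c + t * I)) := by
  obtain ⟨hzarg, hz0⟩ := mem_slitPlane_iff_arg.1 hz
  have harg : |arg z| < Real.pi := abs_lt.2 ⟨neg_pi_lt_arg z, (arg_le_pi z).lt_of_ne hzarg⟩
  set θ : ℝ := (|arg z| + Real.pi) / 4 with hθdef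
  have hθ0 : 0 ≤ θ := by positivity
  have hθ : |θ| < Real.pi / 2 := by
    rw [abs_of_nonneg hθ0]
    linarith
  have hk : 0 < 2 * θ - |arg z| := by linarith
  have hcos : 0 < Real.cos θ := Real.cos_pos_of_mem_Ioo (abs_lt.1 hθ)
  have hcξ' : 0 < ξ.re - c := sub_pos.2 hcξ
  have hcont : Continuous fun t : ℝ =>
      Gamma (ξ - (c + t * I)) * Gamma (c + t * I) * z ^ (-(c + t * I)) := by
    have hΓ {g : ℝ → ℂ} (hg : Continuous g) (hpos : ∀ t, 0 < (g t).re) :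
        Continuous fun t => Gamma (g t) :=
      continuous_iff_continuousAt.2 fun t =>
        (differentiableAt_Gamma (g t) fun m hm => by
          have := hpos t
          rw [hm, neg_re, natCast_re] at this
          linarith [m.cast_nonneg (α := ℝ)]).continuousAt.comp hg.continuousAt
    refine ((hΓ (by fun_prop) fun t => ?_).mul (hΓ (by fun_prop) fun t => ?_)).mul
      (Continuous.const_cpow (by fun_prop) (Or.inl hz0))
    · simpa using hcξ
    · simpa using hc0
  refine ((integrable_exp_neg_mul_abs hk).const_mul
    ((1 / Real.cos θ) ^ (ξ.re - c) * Real.Gamma (ξ.re - c) * Real.exp (θ * |ξ.im|) *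
      ((1 / Real.cos θ) ^ c * Real.Gamma c) * ‖z‖ ^ (-c))).mono' hcont.aestronglyMeasurable
    (.of_forall fun t => ?_)
  have h₁ := norm_Gamma_le_exp_neg_mul_abs_im (s := ξ - (c + t * I)) (by simpa using hcξ) hθ
  have h₂ := norm_Gamma_le_exp_neg_mul_abs_im (s := c + t * I) (by simpa using hc0) hθ
  have h₃ : ‖z ^ (-(c + t * I))‖ ≤ ‖z‖ ^ (-c) * Real.exp (|arg z| * |t|) := by
    rw [norm_cpow_of_ne_zero hz0, div_eq_mul_inv, ← Real.exp_neg, ← abs_mul]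
    simp only [neg_re, add_re, ofReal_re, mul_re, I_re, mul_zero, ofReal_im, I_im, mul_one,
      sub_self, add_zero, neg_im, add_im, mul_im, zero_add, mul_neg, neg_neg]
    exact mul_le_mul_of_nonneg_left (Real.exp_le_exp.2 (le_abs_self _)) (by positivity)
  simp only [sub_re, add_re, ofReal_re, mul_re, I_re, mul_zero, ofReal_im, I_im, mul_one, sub_self,
    add_zero, sub_im, add_im, mul_im, zero_add] at h₁ h₂
  have h₁' : Real.exp (-(θ * |ξ.im - t|)) ≤ Real.exp (θ * |ξ.im|) * Real.exp (-(θ * |t|)) := by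
    rw [← Real.exp_add, Real.exp_le_exp]
    have : |t| - |ξ.im| ≤ |ξ.im - t| := abs_sub_comm ξ.im t ▸ abs_sub_abs_le_abs_sub t ξ.im
    nlinarith
  have hexp : Real.exp (-((2 * θ - |arg z|) * |t|)) =
      Real.exp (-(θ * |t|)) * Real.exp (-(θ * |t|)) * Real.exp (|arg z| * |t|) := by
    rw [← Real.exp_add, ← Real.exp_add]
    ring_nf
  rw [norm_mul, norm_mul, hexp]
  have hΓ₁ := Real.Gamma_pos_of_pos hcξ'
  have hΓ₂ := Real.Gamma_pos_of_pos hc0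
  calc _ ≤ ((1 / Real.cos θ) ^ (ξ.re - c) * Real.Gamma (ξ.re - c) *
          (Real.exp (θ * |ξ.im|) * Real.exp (-(θ * |t|)))) *
        ((1 / Real.cos θ) ^ c * Real.Gamma c * Real.exp (-(θ * |t|))) *
        (‖z‖ ^ (-c) * Real.exp (|arg z| * |t|)) := by
        gcongr
        exact h₁.trans (by gcongr)
    _ = _ := by ring

/-- The pair `a = z ^ (-1/2)`, `b = z ^ (1/2)` lies in the right half-plane, where the principal
powers of its products behave multiplicatively. -/
lemma exists_sqrt_cpow_factorization {z : ℂ} (hz : z ∈ slitPlane) :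
    ∃ a b : ℂ, 0 < a.re ∧ 0 < b.re ∧
      (∀ s ξ : ℂ, a ^ (s - ξ) * b ^ (-s) = b ^ ξ * z ^ (-s)) ∧
      ∀ ξ : ℂ, (a + b) ^ (-ξ) = b ^ ξ * (1 + z) ^ (-ξ) := by
  obtain ⟨hzarg, hz0⟩ := mem_slitPlane_iff_arg.1 hz
  have hlt : arg z < Real.pi := (arg_le_pi z).lt_of_ne hzarg
  have hgt := neg_pi_lt_arg z
  have him : (log z / 2).im = arg z / 2 := by simp [log_im]
  have hre {w : ℂ} (h₁ : -(Real.pi / 2) < w.im) (h₂ : w.im < Real.pi / 2) : 0 < (exp w).re := by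
    rw [exp_re]
    exact mul_pos (Real.exp_pos _) (Real.cos_pos_of_mem_Ioo ⟨h₁, h₂⟩)
  have ha : 0 < (exp (-(log z / 2))).re :=
    hre (by rw [neg_im, him]; linarith) (by rw [neg_im, him]; linarith)
  have hb : 0 < (exp (log z / 2)).re := hre (by rw [him]; linarith) (by rw [him]; linarith)
  refine ⟨exp (-(log z / 2)), exp (log z / 2), ha, hb, fun s ξ => ?_, fun ξ => ?_⟩
  · rw [cpow_def_of_ne_zero (exp_ne_zero _), cpow_def_of_ne_zero (exp_ne_zero _),
      cpow_def_of_ne_zero (exp_ne_zero _), cpow_def_of_ne_zero hz0,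
      log_exp (by rw [neg_im, him]; linarith) (by rw [neg_im, him]; linarith),
      log_exp (by rw [him]; linarith) (by rw [him]; linarith), ← exp_add, ← exp_add]
    ring_nf
  · have hab : 0 < (exp (-(log z / 2)) + exp (log z / 2)).re := add_pos ha hb
    have hab0 : exp (-(log z / 2)) + exp (log z / 2) ≠ 0 := by
      intro h
      simp [h] at hab
    have hprod : 1 + z = exp (log z / 2) * (exp (-(log z / 2)) + exp (log z / 2)) := by
      rw [mul_add, ← exp_add, ← exp_add, add_neg_cancel, exp_zero, add_halves, exp_log hz0]
    have h₁ := abs_lt.1 (abs_arg_lt_pi_div_two_iff.2 (Or.inl hb))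
    have h₂ := abs_lt.1 (abs_arg_lt_pi_div_two_iff.2 (Or.inl hab))
    rw [hprod, mul_cpow_of_arg_add_mem_Ioc (exp_ne_zero _) hab0 ⟨by linarith, by linarith⟩,
      ← mul_assoc, ← cpow_add _ _ (exp_ne_zero _), add_neg_cancel, cpow_zero, one_mul]

end Complex

theorem stmt10 (ξ z : ℂ) (hξ : 0 < ξ.re) (hz : ∀ x : ℝ, x ≤ 0 → z ≠ (x : ℂ))
    (c : ℝ) (hc0 : 0 < c) (hcξ : c < ξ.re) :
    Integrable (fun t : ℝ =>
      Complex.Gamma (ξ - (c + t*Complex.I)) * Complex.Gamma (c + t*Complex.I) *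
        z ^ (-(c + t*Complex.I))) ∧
    ((1 / (2*Real.pi) : ℝ) : ℂ) *
        ∫ t : ℝ, Complex.Gamma (ξ - (c + t*Complex.I)) * Complex.Gamma (c + t*Complex.I) *
          z ^ (-(c + t*Complex.I)) =
      Complex.Gamma ξ * (1 + z) ^ (-ξ) := by
  have hz' : z ∈ Complex.slitPlane := by
    rw [Complex.mem_slitPlane_iff]
    by_contra! h
    exact hz z.re h.1 (Complex.ext rfl h.2)
  have hint := Complex.integrable_Gamma_mul_Gamma_mul_cpow (ξ := ξ) hz' hc0 hcξ
  refine ⟨hint, ?_⟩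
  obtain ⟨a, b, ha, hb, hpow, hadd⟩ := Complex.exists_sqrt_cpow_factorization hz'
  have hb0 : b ≠ 0 := by
    rintro rfl
    simp at hb
  have hM (t : ℝ) := Complex.hasMellin_Gamma_mul_add_mul_cpow (s := c + t * Complex.I) (ξ := ξ)
    ha hb (by simpa using hc0) (by simpa using hcξ)
  have heq (t : ℝ) : mellin (fun x : ℝ => Complex.Gamma ξ * (a + b * x) ^ (-ξ))
      (c + t * Complex.I) = b ^ ξ * (Complex.Gamma (ξ - (c + t*Complex.I)) *
        Complex.Gamma (c + t*Complex.I) * z ^ (-(c + t*Complex.I))) := by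
    rw [(hM t).2, hpow]
    ring
  have hinv := mellinInv_mellin_eq c (fun x : ℝ => Complex.Gamma ξ * (a + b * x) ^ (-ξ)) one_pos
    (by simpa using (hM 0).1)
    (by simpa only [Complex.VerticalIntegrable, heq] using hint.const_mul (b ^ ξ))
    (by
      refine continuousAt_const.mul (ContinuousAt.cpow (by fun_prop) continuousAt_const ?_)
      exact Or.inl (by simpa using add_pos ha hb))
  simp only [mellinInv, heq, Complex.ofReal_one, Complex.one_cpow, one_smul, mul_one,
    integral_const_mul, hadd, Complex.real_smul] at hinv
  refine mul_left_cancel₀ (Complex.cpow_ne_zero_iff.2 (Or.inl hb0) : b ^ ξ ≠ 0) ?_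
  linear_combination hinv
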